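/- Assume (A2), (A3) and the normalization ψ(ξ) = 1 for |ξ| = 1. For s ≥ 1 with s·t ≥ t₀ define p_t^s(x) = (2π)^{-d} ∫_{ℝ^d} e^{-iξ·x} e^{-t ψ^s(ξ)} dξ, where ψ^s(ξ) = s·ψ(ψ^{-1}(1/s)ξ), and let p_t^α(x) = (2π)^{-d} ∫_{ℝ^d} e^{-iξ·x − t|ξ|^α} dξ. Then for every t > 0 and every x ∈ ℝ^d, lim_{s→∞} p_t^s(x) = p_t^α(x). -/

import Mathlib

open MeasureTheory Filter Real
open scoped RealInnerProductSpace

noncomputable section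

/-- Pruitt's concentration function `K(r) = r⁻² ∫_{|z|<r} |z|² ν(|z|) dz`. -/
def K (d : ℕ) (ν : ℝ → ℝ) (r : ℝ) : ℝ :=
  (∫ z in Metric.ball (0 : EuclideanSpace ℝ (Fin d)) r, ‖z‖ ^ 2 * ν ‖z‖) / r ^ 2

/-- Pruitt's concentration function `h(r) = ∫ (|z|²/r² ∧ 1) ν(|z|) dz`. -/
def hfun (d : ℕ) (ν : ℝ → ℝ) (r : ℝ) : ℝ :=
  ∫ z : EuclideanSpace ℝ (Fin d), min (‖z‖ ^ 2 / r ^ 2) 1 * ν ‖z‖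

/-- The characteristic (Lévy–Khintchine) exponent `ψ(ξ) = ∫ (1 - cos⟪ξ,z⟫) ν(|z|) dz`. -/
def ψ (d : ℕ) (ν : ℝ → ℝ) (ξ : EuclideanSpace ℝ (Fin d)) : ℝ :=
  ∫ z : EuclideanSpace ℝ (Fin d), (1 - Real.cos ⟪ξ, z⟫) * ν ‖z‖

/-- The radial nondecreasing majorant `ψ*(r) = sup_{|z| ≤ r} ψ(z)`. -/
def ψstar (d : ℕ) (ν : ℝ → ℝ) (r : ℝ) : ℝ :=
  sSup {y : ℝ | ∃ z : EuclideanSpace ℝ (Fin d), ‖z‖ ≤ r ∧ ψ d ν z = y}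

/-- The generalized inverse `ψ⁻¹(u) = sup {r ≥ 0 : ψ*(r) = u}`. -/
def ψinv (d : ℕ) (ν : ℝ → ℝ) (u : ℝ) : ℝ :=
  sSup {r : ℝ | 0 ≤ r ∧ ψstar d ν r = u}

/-- Characteristic exponent `ψˢ(ξ) = s·ψ(ψ⁻¹(1/s)ξ)` of the rescaled process. -/
def ψs (d : ℕ) (ν : ℝ → ℝ) (s : ℝ) (ξ : EuclideanSpace ℝ (Fin d)) : ℝ :=
  s * ψ d ν (ψinv d ν (1 / s) • ξ)

/-- Lévy density `νˢ(x) = s·ψ⁻¹(1/s)^{-d}·ν(x/ψ⁻¹(1/s))` of the rescaled process. -/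
def νs (d : ℕ) (ν : ℝ → ℝ) (s : ℝ) (x : EuclideanSpace ℝ (Fin d)) : ℝ :=
  s / ψinv d ν (1 / s) ^ d * ν (‖x‖ / ψinv d ν (1 / s))

/-- `ψ^{-1,s}(u) = ψ⁻¹(u/s)/ψ⁻¹(1/s)`. -/
def ψinvs (d : ℕ) (ν : ℝ → ℝ) (s u : ℝ) : ℝ :=
  ψinv d ν (u / s) / ψinv d ν (1 / s)

/-- The stable constant `𝒜(d,α)`. -/
def Aconst (d : ℕ) (α : ℝ) : ℝ :=
  α * (2 : ℝ) ^ (α - 1) * Real.Gamma (((d : ℝ) + α) / 2) /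
    (Real.Gamma (1 - α / 2) * Real.pi ^ ((d : ℝ) / 2))

/-- Heat kernel of the rescaled process, via Fourier inversion. -/
def pts (d : ℕ) (ν : ℝ → ℝ) (s t : ℝ) (x : EuclideanSpace ℝ (Fin d)) : ℝ :=
  ((2 * Real.pi) ^ d)⁻¹ *
    ∫ ξ : EuclideanSpace ℝ (Fin d), Real.cos ⟪ξ, x⟫ * Real.exp (-(t * ψs d ν s ξ))

/-- Heat kernel of the isotropic α-stable process. -/
def ptα (d : ℕ) (α t : ℝ) (x : EuclideanSpace ℝ (Fin d)) : ℝ :=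
  ((2 * Real.pi) ^ d)⁻¹ *
    ∫ ξ : EuclideanSpace ℝ (Fin d), Real.cos ⟪ξ, x⟫ * Real.exp (-(t * ‖ξ‖ ^ α))

/-- Heat kernel of the original process, via Fourier inversion. -/
def pt (d : ℕ) (ν : ℝ → ℝ) (t : ℝ) (x : EuclideanSpace ℝ (Fin d)) : ℝ :=
  ((2 * Real.pi) ^ d)⁻¹ *
    ∫ ξ : EuclideanSpace ℝ (Fin d), Real.cos ⟪ξ, x⟫ * Real.exp (-(t * ψ d ν ξ))

section Exponent

variable {d : ℕ} {ν : ℝ → ℝ}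

/-- The exponent depends on `ξ` only through its norm. -/
lemma ψ_eq_of_norm_eq (G : ℝ → ℝ) {ξ η : EuclideanSpace ℝ (Fin d)} (h : ‖ξ‖ = ‖η‖) :
    ψ d G ξ = ψ d G η := by
  set T := (Submodule.span ℝ {ξ - η})ᗮ.reflection with hT
  have hTξ : T ξ = η := Submodule.reflection_sub h
  have key := T.measurePreserving.integral_comp T.toHomeomorph.measurableEmbedding
    (fun z => (1 - Real.cos ⟪η, z⟫) * G ‖z‖)
  unfold ψ
  rw [← key]
  refine integral_congr_ae (Eventually.of_forall fun z => ?_)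
  simp only [LinearIsometryEquiv.norm_map]
  rw [← hTξ, LinearIsometryEquiv.inner_map_map]

/-- Scaling of the exponent. -/
lemma ψ_smul (G : ℝ → ℝ) {a : ℝ} (ha : 0 < a) (ξ : EuclideanSpace ℝ (Fin d)) :
    ψ d G (a • ξ) = (a ^ d)⁻¹ * ψ d (fun r => G (r / a)) ξ := by
  have key := Measure.integral_comp_smul (volume : Measure (EuclideanSpace ℝ (Fin d)))
    (fun z => (1 - Real.cos ⟪ξ, z⟫) * G (‖z‖ / a)) a
  rw [finrank_euclideanSpace_fin, abs_of_pos (by positivity), smul_eq_mul] at key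
  unfold ψ
  rw [← key]
  refine integral_congr_ae (Eventually.of_forall fun z => ?_)
  simp only [norm_smul, Real.norm_eq_abs, abs_of_pos ha, real_inner_smul_left,
    real_inner_smul_right]
  rw [mul_div_cancel_left₀ _ ha.ne']

lemma one_sub_cos_inner_le (ξ z : EuclideanSpace ℝ (Fin d)) :
    1 - Real.cos ⟪ξ, z⟫ ≤ (‖ξ‖ ^ 2 + 2) * min (‖z‖ ^ 2) 1 := by
  rcases le_total (‖z‖ ^ 2) 1 with h | h
  · rw [min_eq_left h]
    have h1 := Real.one_sub_sq_div_two_le_cos (x := ⟪ξ, z⟫)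
    have h2 : ⟪ξ, z⟫ ^ 2 ≤ (‖ξ‖ * ‖z‖) ^ 2 :=
      sq_le_sq.2 ((abs_real_inner_le_norm ξ z).trans (le_abs_self _))
    nlinarith [sq_nonneg ‖z‖, sq_nonneg (‖ξ‖ * ‖z‖)]
  · rw [min_eq_right h]
    nlinarith [Real.neg_one_le_cos ⟪ξ, z⟫, sq_nonneg ‖ξ‖]

lemma one_sub_cos_nonneg (x : ℝ) : 0 ≤ 1 - Real.cos x := by
  linarith [Real.cos_le_one x]

/-- Lévy integrability of the radial profile `G`. -/
def LevyInt (d : ℕ) (G : ℝ → ℝ) : Prop :=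
  Integrable (fun z : EuclideanSpace ℝ (Fin d) => min (‖z‖ ^ 2) 1 * G ‖z‖)

lemma LevyInt.aestronglyMeasurable {G : ℝ → ℝ} (hG : LevyInt d G)
    (ξ : EuclideanSpace ℝ (Fin d)) :
    AEStronglyMeasurable
      (fun z : EuclideanSpace ℝ (Fin d) => (1 - Real.cos ⟪ξ, z⟫) * G ‖z‖) := by
  have h1 : AEStronglyMeasurable (fun z : EuclideanSpace ℝ (Fin d) =>
      ((1 - Real.cos ⟪ξ, z⟫) / min (‖z‖ ^ 2) 1) * (min (‖z‖ ^ 2) 1 * G ‖z‖)) :=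
    AEStronglyMeasurable.mul (by
      apply Measurable.aestronglyMeasurable
      fun_prop) (Integrable.aestronglyMeasurable hG)
  refine h1.congr (Eventually.of_forall fun z => ?_)
  by_cases hz : z = 0
  · simp [hz]
  · have : 0 < min (‖z‖ ^ 2) 1 := lt_min (by positivity) one_pos
    field_simp

lemma LevyInt.norm_le {G : ℝ → ℝ} (ξ z : EuclideanSpace ℝ (Fin d)) :
    ‖(1 - Real.cos ⟪ξ, z⟫) * G ‖z‖‖ ≤ (‖ξ‖ ^ 2 + 2) * ‖min (‖z‖ ^ 2) 1 * G ‖z‖‖ := by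
  rw [norm_mul, norm_mul, ← mul_assoc, Real.norm_of_nonneg (one_sub_cos_nonneg _),
    Real.norm_of_nonneg (r := min (‖z‖ ^ 2) 1) (by positivity)]
  exact mul_le_mul_of_nonneg_right (one_sub_cos_inner_le ξ z) (norm_nonneg _)

lemma LevyInt.integrable {G : ℝ → ℝ} (hG : LevyInt d G) (ξ : EuclideanSpace ℝ (Fin d)) :
    Integrable (fun z : EuclideanSpace ℝ (Fin d) => (1 - Real.cos ⟪ξ, z⟫) * G ‖z‖) :=
  (Integrable.norm hG |>.const_mul (‖ξ‖ ^ 2 + 2)).mono' (hG.aestronglyMeasurable ξ)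
    (Eventually.of_forall fun z => LevyInt.norm_le ξ z)

lemma LevyInt.continuous_ψ {G : ℝ → ℝ} (hG : LevyInt d G) : Continuous (ψ d G) := by
  rw [continuous_iff_continuousAt]
  intro ξ₀
  refine continuousAt_of_dominated
    (bound := fun z => ((‖ξ₀‖ + 1) ^ 2 + 2) * ‖min (‖z‖ ^ 2) 1 * G ‖z‖‖)
    (Eventually.of_forall hG.aestronglyMeasurable) ?_ (Integrable.norm hG |>.const_mul _) ?_
  · filter_upwards [Metric.ball_mem_nhds ξ₀ one_pos] with ξ hξ
    have h1 : ‖ξ‖ ≤ ‖ξ₀‖ + 1 := by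
      have := norm_le_insert' ξ ξ₀
      rw [Metric.mem_ball, dist_eq_norm] at hξ
      linarith
    refine Eventually.of_forall fun z => (LevyInt.norm_le ξ z).trans ?_
    gcongr
  · exact Eventually.of_forall fun z => by fun_prop

lemma ψ_zero (G : ℝ → ℝ) : ψ d G 0 = 0 := by
  simp [ψ]

lemma ψ_nonneg {G : ℝ → ℝ} (hG : ∀ r, 0 < r → 0 ≤ G r) (ξ : EuclideanSpace ℝ (Fin d)) :
    0 ≤ ψ d G ξ := by
  refine integral_nonneg fun z => ?_
  by_cases hz : z = 0
  · simp [hz]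
  · exact mul_nonneg (one_sub_cos_nonneg _) (hG _ (norm_pos_iff.2 hz))

lemma ψ_mono {F G : ℝ → ℝ} (hF : LevyInt d F) (hG : LevyInt d G)
    (h : ∀ r, 0 < r → F r ≤ G r) (ξ : EuclideanSpace ℝ (Fin d)) : ψ d F ξ ≤ ψ d G ξ := by
  refine integral_mono (hF.integrable ξ) (hG.integrable ξ) fun z => ?_
  by_cases hz : z = 0
  · simp [hz]
  · exact mul_le_mul_of_nonneg_left (h _ (norm_pos_iff.2 hz)) (one_sub_cos_nonneg _)

lemma ψ_const_mul (c : ℝ) (G : ℝ → ℝ) (ξ : EuclideanSpace ℝ (Fin d)) :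
    ψ d (fun r => c * G r) ξ = c * ψ d G ξ := by
  unfold ψ
  rw [← integral_const_mul]
  exact integral_congr_ae (Eventually.of_forall fun z => by ring)

lemma ψ_add {F G : ℝ → ℝ} (hF : LevyInt d F) (hG : LevyInt d G)
    (ξ : EuclideanSpace ℝ (Fin d)) :
    ψ d (fun r => F r + G r) ξ = ψ d F ξ + ψ d G ξ := by
  unfold ψ
  rw [← integral_add (hF.integrable ξ) (hG.integrable ξ)]
  exact integral_congr_ae (Eventually.of_forall fun z => by ring)

/-- The profile of the uniform density on a ball. -/
abbrev ballProfile (R : ℝ) : ℝ → ℝ := Set.indicator (Set.Iic R) 1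

lemma ballProfile_nonneg (R r : ℝ) : 0 ≤ ballProfile R r :=
  Set.indicator_nonneg (fun _ _ => zero_le_one) r

lemma levyInt_ballProfile (R : ℝ) : LevyInt d (ballProfile R) := by
  have h : IntegrableOn (fun _ : EuclideanSpace ℝ (Fin d) => (1 : ℝ))
      (Metric.closedBall 0 R) :=
    integrableOn_const (measure_closedBall_lt_top.ne)
  rw [← integrable_indicator_iff measurableSet_closedBall] at h
  refine h.mono' ?_ (Eventually.of_forall fun z => ?_)
  · apply Measurable.aestronglyMeasurable
    have : Measurable (ballProfile R) := measurable_one.indicator measurableSet_Iic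
    fun_prop
  · by_cases hz : ‖z‖ ≤ R
    · simp only [ballProfile, Set.indicator, Set.mem_Iic, hz, if_true, Pi.one_apply, mul_one,
        mem_closedBall_zero_iff]
      rw [Real.norm_of_nonneg (by positivity)]
      exact min_le_right _ _
    · simp [ballProfile, hz, Set.indicator]

lemma ψ_ballProfile_one_pos {e : EuclideanSpace ℝ (Fin d)} (he : ‖e‖ = 1) :
    0 < ψ d (ballProfile 1) e := by
  unfold ψ
  rw [integral_pos_iff_support_of_nonneg
    (fun z => mul_nonneg (one_sub_cos_nonneg _) (ballProfile_nonneg _ _))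
    ((levyInt_ballProfile 1).integrable e)]
  refine (Metric.measure_ball_pos volume ((1 / 2 : ℝ) • e) (r := 1 / 4) (by norm_num)).trans_le
    (measure_mono fun z hz => ?_)
  rw [Metric.mem_ball, dist_eq_norm] at hz
  have h1 : ‖z‖ ≤ 1 := by
    have h2 := norm_le_insert' z ((1 / 2 : ℝ) • e)
    have h3 : ‖(1 / 2 : ℝ) • e‖ = 1 / 2 := by simp [norm_smul, he]
    linarith
  have h4 : |⟪e, z⟫ - 1 / 2| < 1 / 4 := by
    have h5 : ⟪e, z⟫ - 1 / 2 = ⟪e, z - (1 / 2 : ℝ) • e⟫ := by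
      rw [inner_sub_right, real_inner_smul_right, real_inner_self_eq_norm_sq, he]
      norm_num
    rw [h5]
    refine (abs_real_inner_le_norm _ _).trans_lt ?_
    rwa [he, one_mul]
  rw [abs_lt] at h4
  have h6 : Real.cos ⟪e, z⟫ < 1 := by
    rw [← Real.cos_zero]
    exact Real.cos_lt_cos_of_nonneg_of_le_pi le_rfl (by linarith [Real.pi_gt_three])
      (by linarith)
  simp only [Function.mem_support, ballProfile, Set.indicator, Set.mem_Iic, h1, if_true,
    Pi.one_apply, mul_one]
  linarith

/-- Lower bound of the exponent by the profile at the dual scale. -/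
lemma le_ψ_of_antitone {G : ℝ → ℝ} (hG : LevyInt d G) (hpos : ∀ r, 0 < r → 0 ≤ G r)
    (hanti : ∀ r₁ r₂ : ℝ, 0 < r₁ → r₁ ≤ r₂ → G r₂ ≤ G r₁)
    {e : EuclideanSpace ℝ (Fin d)} (he : ‖e‖ = 1)
    {ξ : EuclideanSpace ℝ (Fin d)} (hξ : ξ ≠ 0) :
    ψ d (ballProfile 1) e * (G ‖ξ‖⁻¹ / ‖ξ‖ ^ d) ≤ ψ d G ξ := by
  have hn : 0 < ‖ξ‖ := norm_pos_iff.2 hξ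
  have h1 : ψ d (ballProfile 1) e = ψ d (ballProfile 1) (‖ξ‖⁻¹ • ξ) :=
    ψ_eq_of_norm_eq _ (by rw [he, norm_smul, norm_inv, norm_norm, inv_mul_cancel₀ hn.ne'])
  rw [h1, ψ_smul _ (inv_pos.2 hn)]
  have h2 : ψ d (fun r => G ‖ξ‖⁻¹ * ballProfile 1 (r / ‖ξ‖⁻¹)) ξ ≤ ψ d G ξ := by
    have hF : LevyInt d (fun r => G ‖ξ‖⁻¹ * ballProfile 1 (r / ‖ξ‖⁻¹)) := by
      have := Integrable.const_mul (levyInt_ballProfile (d := d) ‖ξ‖⁻¹) (G ‖ξ‖⁻¹)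
      refine this.congr (Eventually.of_forall fun z => ?_)
      have : ballProfile 1 (‖z‖ / ‖ξ‖⁻¹) = ballProfile ‖ξ‖⁻¹ ‖z‖ := by
        simp only [ballProfile, Set.indicator, Set.mem_Iic, div_le_one (inv_pos.2 hn)]
        rfl
      simp only [this]
      ring
    refine ψ_mono hF hG (fun r hr => ?_) ξ
    by_cases h : r / ‖ξ‖⁻¹ ≤ 1
    · have h' := (div_le_one (inv_pos.2 hn)).1 h
      simpa only [ballProfile, Set.indicator, Set.mem_Iic, h, if_true,
        Pi.one_apply, mul_one] using hanti r _ hr h'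
    · simpa only [ballProfile, Set.indicator, Set.mem_Iic, h, if_false, mul_zero] using hpos r hr
  rw [ψ_const_mul] at h2
  calc _ = G ‖ξ‖⁻¹ * ψ d (fun r => ballProfile 1 (r / ‖ξ‖⁻¹)) ξ := by
        rw [inv_pow, inv_inv, mul_comm (‖ξ‖ ^ d), mul_assoc,
          mul_div_cancel₀ _ (pow_ne_zero d hn.ne'), mul_comm]
    _ ≤ _ := h2

lemma integrable_ballProfile (R : ℝ) :
    Integrable (fun z : EuclideanSpace ℝ (Fin d) => ballProfile R ‖z‖) := by
  have h : IntegrableOn (fun _ : EuclideanSpace ℝ (Fin d) => (1 : ℝ))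
      (Metric.closedBall 0 R) :=
    integrableOn_const (measure_closedBall_lt_top.ne)
  rw [← integrable_indicator_iff measurableSet_closedBall] at h
  refine h.congr (Eventually.of_forall fun z => ?_)
  simp [ballProfile, Set.indicator]

/-- Riemann–Lebesgue for the exponent of the uniform density on the unit ball. -/
lemma tendsto_ψ_ballProfile_one :
    Tendsto (ψ d (ballProfile 1)) (cocompact (EuclideanSpace ℝ (Fin d)))
      (nhds (∫ z : EuclideanSpace ℝ (Fin d), ballProfile 1 ‖z‖)) := by
  have hm : Measurable (ballProfile 1) := measurable_one.indicator measurableSet_Iic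
  have hB := integrable_ballProfile (d := d) 1
  have h1 := tendsto_integral_exp_inner_smul_cocompact
    (fun z : EuclideanSpace ℝ (Fin d) => ((ballProfile 1 ‖z‖ : ℝ) : ℂ))
  have hπ : (2 * Real.pi)⁻¹ ≠ 0 := by positivity
  have h2 : Tendsto (fun ξ : EuclideanSpace ℝ (Fin d) => (2 * Real.pi)⁻¹ • ξ)
      (cocompact _) (cocompact _) :=
    (Homeomorph.smulOfNeZero _ hπ).isClosedEmbedding.tendsto_cocompact
  have h3 := (Complex.continuous_re.tendsto 0).comp (h1.comp h2)
  have h4 : (fun ξ : EuclideanSpace ℝ (Fin d) =>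
      (∫ z : EuclideanSpace ℝ (Fin d), ballProfile 1 ‖z‖) - (Complex.re ∘
      ((fun w => ∫ v : EuclideanSpace ℝ (Fin d), Real.fourierChar (-⟪v, w⟫) •
        ((ballProfile 1 ‖v‖ : ℝ) : ℂ)) ∘ fun ξ => (2 * Real.pi)⁻¹ • ξ)) ξ) =
      ψ d (ballProfile 1) := by
    funext ξ
    simp only [Function.comp_apply]
    have hint : Integrable (fun v : EuclideanSpace ℝ (Fin d) =>
        Real.fourierChar (-⟪v, (2 * Real.pi)⁻¹ • ξ⟫) • ((ballProfile 1 ‖v‖ : ℝ) : ℂ)) := by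
      refine hB.norm.mono' ?_ (Eventually.of_forall fun v => ?_)
      · apply AEStronglyMeasurable.smul
        · have h : Continuous fun v : EuclideanSpace ℝ (Fin d) => -⟪v, (2 * Real.pi)⁻¹ • ξ⟫ := by
            fun_prop
          exact (continuous_subtype_val.comp
            (Real.continuous_fourierChar.comp h)).aestronglyMeasurable
        · apply Measurable.aestronglyMeasurable
          fun_prop
      · rw [Circle.norm_smul, Complex.norm_real]
    have h5 := Complex.reCLM.integral_comp_comm hint
    simp only [Complex.reCLM_apply] at h5
    rw [← h5]
    have h6 : ∀ v : EuclideanSpace ℝ (Fin d),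
        (Real.fourierChar (-⟪v, (2 * Real.pi)⁻¹ • ξ⟫) • ((ballProfile 1 ‖v‖ : ℝ) : ℂ)).re =
        Real.cos ⟪ξ, v⟫ * ballProfile 1 ‖v‖ := by
      intro v
      have h7 : 2 * Real.pi * -⟪v, (2 * Real.pi)⁻¹ • ξ⟫ = -⟪ξ, v⟫ := by
        rw [real_inner_smul_right, real_inner_comm]
        field_simp
      rw [Circle.smul_def, Real.fourierChar_apply, h7, smul_eq_mul, Complex.re_mul_ofReal,
        Complex.exp_ofReal_mul_I_re, Real.cos_neg]
    simp only [h6]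
    have h8 : Integrable (fun v : EuclideanSpace ℝ (Fin d) =>
        Real.cos ⟪ξ, v⟫ * ballProfile 1 ‖v‖) :=
      hint.re.congr (Eventually.of_forall h6)
    unfold ψ
    rw [← integral_sub hB h8]
    exact integral_congr_ae (Eventually.of_forall fun z => by ring)
  have h9 := (tendsto_const_nhds (x := ∫ z : EuclideanSpace ℝ (Fin d), ballProfile 1 ‖z‖)).sub h3
  rw [Complex.zero_re, sub_zero] at h9
  rw [← h4]
  exact h9

/-- The exponent of a monotone density is bounded away from zero outside every
neighbourhood of the origin. -/
lemma exists_pos_le_ψ (hd : 1 ≤ d) (hν : LevyInt d ν) (hpos : ∀ r, 0 < r → 0 < ν r)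
    (hanti : ∀ r₁ r₂ : ℝ, 0 < r₁ → r₁ ≤ r₂ → ν r₂ ≤ ν r₁) {δ : ℝ} (hδ : 0 < δ) :
    ∃ m > 0, ∀ ξ : EuclideanSpace ℝ (Fin d), δ ≤ ‖ξ‖ → m ≤ ψ d ν ξ := by
  have : Nonempty (Fin d) := ⟨⟨0, hd⟩⟩
  obtain ⟨e, he⟩ := exists_norm_eq (EuclideanSpace ℝ (Fin d)) zero_le_one
  have hc := ψ_ballProfile_one_pos he
  set V := ∫ z : EuclideanSpace ℝ (Fin d), ballProfile 1 ‖z‖ with hV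
  have hVpos : 0 < V := by
    rw [hV, integral_pos_iff_support_of_nonneg
      (fun z => ballProfile_nonneg 1 ‖z‖) (integrable_ballProfile 1)]
    refine (Metric.measure_closedBall_pos volume (0 : EuclideanSpace ℝ (Fin d))
      one_pos).trans_le (measure_mono fun z hz => ?_)
    simpa [ballProfile, Set.indicator] using hz
  have hpos' : ∀ r, 0 < r → 0 ≤ ν r := fun r hr => (hpos r hr).le
  have hlow : ∀ ξ, ν 1 * ψ d (ballProfile 1) ξ ≤ ψ d ν ξ := by
    intro ξ
    rw [← ψ_const_mul]
    refine ψ_mono ?_ hν (fun r hr => ?_) ξ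
    · refine (Integrable.const_mul (levyInt_ballProfile (d := d) 1) (ν 1)).congr
        (Eventually.of_forall fun z => ?_)
      simp only
      ring
    · by_cases h : r ≤ 1
      · simpa [ballProfile, Set.indicator, h] using hanti r 1 hr h
      · simpa [ballProfile, Set.indicator, h] using hpos' r hr
  have hev : ∀ᶠ ξ in cocompact (EuclideanSpace ℝ (Fin d)), V / 2 < ψ d (ballProfile 1) ξ :=
    tendsto_ψ_ballProfile_one.eventually_const_lt (half_lt_self hVpos)
  rw [← Metric.cobounded_eq_cocompact, ← comap_norm_atTop, eventually_comap,
    eventually_atTop] at hev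
  obtain ⟨M, hM⟩ := hev
  set M' := max M δ
  have hM' : 0 < M' := lt_max_of_lt_right hδ
  have hν1 := hpos 1 one_pos
  have hνδ := hpos δ⁻¹ (inv_pos.2 hδ)
  refine ⟨min (ν 1 * (V / 2)) (ψ d (ballProfile 1) e * (ν δ⁻¹ / M' ^ d)),
    lt_min (by positivity) (by positivity), fun ξ hξ => ?_⟩
  rcases le_total M' ‖ξ‖ with h | h
  · refine (min_le_left _ _).trans (le_trans ?_ (hlow ξ))
    have := hM ‖ξ‖ ((le_max_left _ _).trans h) ξ rfl
    gcongr
  · have hn : 0 < ‖ξ‖ := hδ.trans_le hξ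
    refine (min_le_right _ _).trans (le_trans ?_
      (le_ψ_of_antitone hν hpos' hanti he (norm_pos_iff.1 hn)))
    have h1 : ν δ⁻¹ ≤ ν ‖ξ‖⁻¹ := hanti _ _ (inv_pos.2 hn) (inv_anti₀ hδ hξ)
    gcongr
    exact (hpos _ (inv_pos.2 hn)).le

/-- Stable-type profiles satisfy the Lévy integrability condition. -/
lemma levyInt_rpow (hd : 1 ≤ d) {β : ℝ} (hβ : 0 < β) (hβ2 : β < 2) :
    LevyInt d (fun r => r ^ (-(d : ℝ) - β)) := by
  have : Nonempty (Fin d) := ⟨⟨0, hd⟩⟩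
  have key := (integrable_fun_norm_addHaar
    (volume : Measure (EuclideanSpace ℝ (Fin d)))
    (f := fun r : ℝ => min (r ^ 2) 1 * r ^ (-(d : ℝ) - β))).2
  refine key ?_
  rw [finrank_euclideanSpace_fin, ← Set.Ioc_union_Ioi_eq_Ioi (zero_le_one (α := ℝ))]
  have hpow : ∀ r : ℝ, 0 < r → r ^ (d - 1) * r ^ (-(d : ℝ) - β) = r ^ (-1 - β) := by
    intro r hr
    rw [← Real.rpow_natCast, ← Real.rpow_add hr, Nat.cast_sub hd]
    congr 1
    push_cast
    ring
  refine IntegrableOn.union ?_ ?_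
  · have h1 : IntegrableOn (fun r : ℝ => r ^ (1 - β)) (Set.Ioc 0 1) :=
      (intervalIntegrable_iff_integrableOn_Ioc_of_le zero_le_one).1
        (intervalIntegral.intervalIntegrable_rpow' (by linarith))
    refine h1.congr_fun (fun r hr => ?_) measurableSet_Ioc
    have h2 : r ^ 2 ≤ 1 := pow_le_one₀ hr.1.le hr.2
    have h3 : r ^ (1 - β) = r ^ 2 * r ^ (-1 - β) := by
      rw [← Real.rpow_natCast, ← Real.rpow_add hr.1]
      congr 1
      push_cast
      ring
    simp only [min_eq_left h2, smul_eq_mul]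
    rw [h3, ← hpow r hr.1]
    ring
  · have h1 : IntegrableOn (fun r : ℝ => r ^ (-1 - β)) (Set.Ioi 1) :=
      integrableOn_Ioi_rpow_of_lt (by linarith) one_pos
    refine h1.congr_fun (fun r hr => ?_) measurableSet_Ioi
    have hr' : (1 : ℝ) < r := hr
    have h2 : 1 ≤ r ^ 2 := one_le_pow₀ hr'.le
    simp only [min_eq_right h2, smul_eq_mul, one_mul]
    rw [← hpow r (by linarith)]

lemma ψ_rpow_smul (β : ℝ) {a : ℝ} (ha : 0 < a) (ξ : EuclideanSpace ℝ (Fin d)) :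
    ψ d (fun r => r ^ (-(d : ℝ) - β)) (a • ξ) =
      a ^ β * ψ d (fun r => r ^ (-(d : ℝ) - β)) ξ := by
  have h1 : ψ d (fun r => (r / a) ^ (-(d : ℝ) - β)) ξ =
      ψ d (fun r => a ^ ((d : ℝ) + β) * r ^ (-(d : ℝ) - β)) ξ := by
    refine integral_congr_ae (Eventually.of_forall fun z => ?_)
    simp only
    rw [Real.div_rpow (norm_nonneg z) ha.le, div_eq_inv_mul, ← Real.rpow_neg ha.le]
    ring_nf
  rw [ψ_smul _ ha, h1, ψ_const_mul, ← mul_assoc, Real.rpow_add ha, Real.rpow_natCast,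
    inv_mul_cancel_left₀ (pow_ne_zero d ha.ne')]

lemma ψ_rpow_eq (β : ℝ) (hβ : 0 < β) {e : EuclideanSpace ℝ (Fin d)} (he : ‖e‖ = 1)
    (ξ : EuclideanSpace ℝ (Fin d)) :
    ψ d (fun r => r ^ (-(d : ℝ) - β)) ξ =
      ‖ξ‖ ^ β * ψ d (fun r => r ^ (-(d : ℝ) - β)) e := by
  by_cases hξ : ξ = 0
  · rw [hξ, ψ_zero, norm_zero, Real.zero_rpow hβ.ne', zero_mul]
  · rw [← ψ_rpow_smul β (norm_pos_iff.2 hξ)]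
    exact ψ_eq_of_norm_eq _ (by rw [norm_smul, norm_norm, he, mul_one])

/-- The constant of the stable exponent is positive. -/
lemma ψ_rpow_pos (hd : 1 ≤ d) {β : ℝ} (hβ : 0 < β) (hβ2 : β < 2)
    {e : EuclideanSpace ℝ (Fin d)} (he : ‖e‖ = 1) :
    0 < ψ d (fun r => r ^ (-(d : ℝ) - β)) e := by
  have he0 : e ≠ 0 := by
    rintro rfl
    simp at he
  have h := le_ψ_of_antitone (levyInt_rpow hd hβ hβ2) (fun r hr => Real.rpow_nonneg hr.le _)
    (fun r₁ r₂ h1 h2 => Real.rpow_le_rpow_of_nonpos h1 h2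
      (by have : (0 : ℝ) ≤ d := Nat.cast_nonneg d
          linarith)) he he0
  rw [he] at h
  have := ψ_ballProfile_one_pos he
  simp only [inv_one, Real.one_rpow, one_pow, div_one, mul_one] at h
  linarith

end Exponent

section Potter

variable {ν : ℝ → ℝ}

/-- Upper Potter bound from dyadic decay. -/
lemma potter_upper (hpos : ∀ r, 0 < r → 0 < ν r)
    (hanti : ∀ r₁ r₂ : ℝ, 0 < r₁ → r₁ ≤ r₂ → ν r₂ ≤ ν r₁) {q R : ℝ} (hq : 0 < q) (hR : 0 < R)
    (h : ∀ x, R ≤ x → ν (2 * x) ≤ 2 ^ (-q) * ν x) {x l : ℝ} (hx : R ≤ x) (hl : 1 ≤ l) :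
    ν (l * x) ≤ 2 ^ q * l ^ (-q) * ν x := by
  have hx0 : 0 < x := hR.trans_le hx
  have hl0 : 0 < l := one_pos.trans_le hl
  have hind : ∀ n : ℕ, ν (2 ^ n * x) ≤ ((2 : ℝ) ^ n) ^ (-q) * ν x := by
    intro n
    induction n with
    | zero => simp
    | succ n ih =>
      have h1 : R ≤ 2 ^ n * x :=
        hx.trans (le_mul_of_one_le_left hx0.le (one_le_pow₀ one_le_two))
      calc ν (2 ^ (n + 1) * x) = ν (2 * (2 ^ n * x)) := by ring_nf
        _ ≤ 2 ^ (-q) * ν (2 ^ n * x) := h _ h1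
        _ ≤ 2 ^ (-q) * (((2 : ℝ) ^ n) ^ (-q) * ν x) := by gcongr
        _ = _ := by
          rw [pow_succ, Real.mul_rpow (by positivity) (by positivity)]
          ring
  obtain ⟨n, hn1, hn2⟩ := exists_nat_pow_near hl one_lt_two
  have hνx := hpos x hx0
  calc ν (l * x) ≤ ν (2 ^ n * x) := hanti _ _ (by positivity) (by gcongr)
    _ ≤ ((2 : ℝ) ^ n) ^ (-q) * ν x := hind n
    _ ≤ (l / 2) ^ (-q) * ν x := by
      refine mul_le_mul_of_nonneg_right ?_ hνx.le
      refine Real.rpow_le_rpow_of_nonpos (by positivity) ?_ (by linarith)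
      rw [pow_succ] at hn2
      linarith
    _ = _ := by
      rw [Real.div_rpow hl0.le zero_le_two, Real.rpow_neg zero_le_two, div_inv_eq_mul]
      ring

/-- Lower Potter bound from dyadic decay. -/
lemma potter_lower (hpos : ∀ r, 0 < r → 0 < ν r)
    (hanti : ∀ r₁ r₂ : ℝ, 0 < r₁ → r₁ ≤ r₂ → ν r₂ ≤ ν r₁) {q R : ℝ} (hq : 0 < q) (hR : 0 < R)
    (h : ∀ x, R ≤ x → 2 ^ (-q) * ν x ≤ ν (2 * x)) {x l : ℝ} (hx : R ≤ x) (hl : 1 ≤ l) :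
    ν x ≤ 2 ^ q * l ^ q * ν (l * x) := by
  have hx0 : 0 < x := hR.trans_le hx
  have hl0 : 0 < l := one_pos.trans_le hl
  have hstep : ∀ y, R ≤ y → ν y ≤ 2 ^ q * ν (2 * y) := by
    intro y hy
    have h1 := h y hy
    rwa [Real.rpow_neg zero_le_two, inv_mul_le_iff₀ (by positivity)] at h1
  have hind : ∀ n : ℕ, ν x ≤ ((2 : ℝ) ^ n) ^ q * ν (2 ^ n * x) := by
    intro n
    induction n with
    | zero => simp
    | succ n ih =>
      have h1 : R ≤ 2 ^ n * x :=
        hx.trans (le_mul_of_one_le_left hx0.le (one_le_pow₀ one_le_two))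
      calc ν x ≤ ((2 : ℝ) ^ n) ^ q * ν (2 ^ n * x) := ih
        _ ≤ ((2 : ℝ) ^ n) ^ q * (2 ^ q * ν (2 * (2 ^ n * x))) := by
          have := hstep _ h1
          gcongr
        _ = _ := by
          rw [pow_succ, Real.mul_rpow (by positivity) (by positivity)]
          ring_nf
  obtain ⟨n, hn1, hn2⟩ := exists_nat_pow_near hl one_lt_two
  have h2 : ν (2 ^ (n + 1) * x) ≤ ν (l * x) := hanti _ _ (by positivity) (by gcongr)
  have h3 : ((2 : ℝ) ^ (n + 1)) ^ q ≤ (2 * l) ^ q := by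
    refine Real.rpow_le_rpow (by positivity) ?_ hq.le
    rw [pow_succ]
    linarith
  have h4 := hpos (l * x) (by positivity)
  calc ν x ≤ ((2 : ℝ) ^ (n + 1)) ^ q * ν (2 ^ (n + 1) * x) := hind (n + 1)
    _ ≤ ((2 : ℝ) ^ (n + 1)) ^ q * ν (l * x) := by gcongr
    _ ≤ (2 * l) ^ q * ν (l * x) := by gcongr
    _ = _ := by rw [Real.mul_rpow zero_le_two hl0.le]

/-- Two-sided Potter bounds with index `-p` and slack `δ` beyond `R`. -/
def PotterBound (ν : ℝ → ℝ) (p δ R C : ℝ) : Prop :=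
  ∀ x l, R ≤ x → 1 ≤ l →
    ν (l * x) ≤ C * l ^ (-(p - δ)) * ν x ∧ ν x ≤ C * l ^ (p + δ) * ν (l * x)

/-- Potter bounds for a monotone regularly varying function. -/
lemma exists_potter (hpos : ∀ r, 0 < r → 0 < ν r)
    (hanti : ∀ r₁ r₂ : ℝ, 0 < r₁ → r₁ ≤ r₂ → ν r₂ ≤ ν r₁) {p δ : ℝ} (hδ : 0 < δ) (hδp : δ < p)
    (hrv : Tendsto (fun r : ℝ => ν (2 * r) / ν r) atTop (nhds (2 ^ (-p)))) :
    ∃ R > 0, ∃ C > 0, PotterBound ν p δ R C := by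
  have h1 : (2 : ℝ) ^ (-p) < 2 ^ (-(p - δ)) :=
    Real.rpow_lt_rpow_of_exponent_lt one_lt_two (by linarith)
  have h2 : (2 : ℝ) ^ (-(p + δ)) < 2 ^ (-p) :=
    Real.rpow_lt_rpow_of_exponent_lt one_lt_two (by linarith)
  obtain ⟨R, hR⟩ := eventually_atTop.1
    ((hrv.eventually_lt_const h1).and (hrv.eventually_const_lt h2))
  have hR1 : 0 < max R 1 := lt_max_of_lt_right one_pos
  refine ⟨max R 1, hR1, 2 ^ (p + δ), by positivity, fun x l hx hl => ⟨?_, ?_⟩⟩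
  · have h3 := potter_upper hpos hanti (by linarith : 0 < p - δ) hR1 (fun y hy => by
      have := (hR y ((le_max_left _ _).trans hy)).1
      rw [div_lt_iff₀ (hpos y (hR1.trans_le hy))] at this
      exact this.le) hx hl
    refine h3.trans ?_
    have h4 := hpos x (hR1.trans_le hx)
    have h5 : (2 : ℝ) ^ (p - δ) ≤ 2 ^ (p + δ) :=
      Real.rpow_le_rpow_of_exponent_le one_le_two (by linarith)
    gcongr
  · exact potter_lower hpos hanti (by linarith : 0 < p + δ) hR1 (fun y hy => by
      have := (hR y ((le_max_left _ _).trans hy)).2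
      rw [lt_div_iff₀ (hpos y (hR1.trans_le hy))] at this
      exact this.le) hx hl

end Potter

section RegularVariation

variable {d : ℕ} {ν : ℝ → ℝ} {α δ R C : ℝ}

lemma LevyInt.indicator {G : ℝ → ℝ} (hG : LevyInt d G) {S : Set ℝ} (hS : MeasurableSet S) :
    LevyInt d (S.indicator G) := by
  have h := Integrable.indicator hG (measurable_norm hS :
    MeasurableSet ((fun z : EuclideanSpace ℝ (Fin d) => ‖z‖) ⁻¹' S))
  refine h.congr (Eventually.of_forall fun z => ?_)
  by_cases hz : ‖z‖ ∈ S
  · simp [Set.indicator, hz]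
  · simp [Set.indicator, hz]

/-- Truncated small jumps contribute quadratically to the exponent. -/
lemma exists_ψ_indicator_Iio_le {G : ℝ → ℝ} (hG : LevyInt d G) (hpos : ∀ r, 0 < r → 0 < G r)
    (R : ℝ) : ∃ M, ∀ ξ : EuclideanSpace ℝ (Fin d),
      ψ d ((Set.Iio R).indicator G) ξ ≤ ‖ξ‖ ^ 2 * M := by
  have hG1 : LevyInt d ((Set.Iio R).indicator G) := hG.indicator measurableSet_Iio
  refine ⟨(R ^ 2 + 1) * ∫ z : EuclideanSpace ℝ (Fin d),
    min (‖z‖ ^ 2) 1 * (Set.Iio R).indicator G ‖z‖, fun ξ => ?_⟩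
  rw [← mul_assoc, ← integral_const_mul]
  refine integral_mono (hG1.integrable ξ) (Integrable.const_mul hG1 _) fun z => ?_
  by_cases hz0 : z = 0
  · simp [hz0]
  have hz1 := norm_pos_iff.2 hz0
  by_cases hz : ‖z‖ < R
  · simp only [Set.indicator, Set.mem_Iio, hz, if_true]
    rw [← mul_assoc]
    refine mul_le_mul_of_nonneg_right ?_ (hpos _ hz1).le
    have h1 := Real.one_sub_sq_div_two_le_cos (x := ⟪ξ, z⟫)
    have h2 : ⟪ξ, z⟫ ^ 2 ≤ (‖ξ‖ * ‖z‖) ^ 2 :=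
      sq_le_sq.2 ((abs_real_inner_le_norm ξ z).trans (le_abs_self _))
    have h3 : ‖z‖ ^ 2 ≤ (R ^ 2 + 1) * min (‖z‖ ^ 2) 1 := by
      have h4 : ‖z‖ ^ 2 ≤ R ^ 2 := by gcongr
      rcases le_total (‖z‖ ^ 2) 1 with h | h
      · rw [min_eq_left h]
        nlinarith [sq_nonneg R, sq_nonneg ‖z‖]
      · rw [min_eq_right h]
        linarith
    have h5 := mul_le_mul_of_nonneg_left h3 (sq_nonneg ‖ξ‖)
    nlinarith [sq_nonneg (‖ξ‖ * ‖z‖)]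
  · simp [Set.indicator, hz]

lemma PotterBound.ratio_le (hP : PotterBound ν (d + α) δ R C) (hC : 0 < C)
    (hpos : ∀ r, 0 < r → 0 < ν r) {a r : ℝ} (ha : 0 < a) (haR : R ≤ a⁻¹) (hr : 0 < r) :
    (ν a⁻¹)⁻¹ * (Set.Ici R).indicator ν (r / a) ≤
      C * (r ^ (-(d : ℝ) - (α - δ)) + r ^ (-(d : ℝ) - (α + δ))) := by
  have hν := hpos _ (inv_pos.2 ha)
  have hr1 : 0 < r ^ (-(d : ℝ) - (α - δ)) := Real.rpow_pos_of_pos hr _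
  have hr2 : 0 < r ^ (-(d : ℝ) - (α + δ)) := Real.rpow_pos_of_pos hr _
  by_cases h : R ≤ r / a
  · simp only [Set.indicator, Set.mem_Ici, h, if_true]
    rw [inv_mul_le_iff₀ hν]
    rcases le_total 1 r with h1 | h1
    · have h2 := (hP a⁻¹ r haR h1).1
      rw [div_eq_mul_inv]
      refine h2.trans ?_
      have h3 : -((d : ℝ) + α - δ) = -(d : ℝ) - (α - δ) := by ring
      rw [h3]
      nlinarith [mul_pos hν (mul_pos hC hr2)]
    · have h2 := (hP (r / a) r⁻¹ h ((one_le_inv₀ hr).2 h1)).2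
      have h4 : r⁻¹ * (r / a) = a⁻¹ := by field_simp
      rw [h4, Real.inv_rpow hr.le, ← Real.rpow_neg hr.le] at h2
      refine h2.trans ?_
      have h3 : -((d : ℝ) + α + δ) = -(d : ℝ) - (α + δ) := by ring
      rw [h3]
      nlinarith [mul_pos hν (mul_pos hC hr1)]
  · simp only [Set.indicator, Set.mem_Ici, h, if_false, mul_zero]
    positivity

/-- Small jumps are negligible for the rescaled exponent. -/
lemma tendsto_ψ_small_div (hν : LevyInt d ν) (hpos : ∀ r, 0 < r → 0 < ν r)
    (hδ2 : α + δ < 2) (hR : 0 < R)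
    (hP : PotterBound ν (d + α) δ R C) (ξ₀ : EuclideanSpace ℝ (Fin d)) :
    Tendsto (fun x : ℝ × EuclideanSpace ℝ (Fin d) =>
        ψ d ((Set.Iio R).indicator ν) (x.1 • x.2) / (ν x.1⁻¹ / x.1 ^ d))
      (nhdsWithin 0 (Set.Ioi 0) ×ˢ nhds ξ₀) (nhds 0) := by
  obtain ⟨M, hM⟩ := exists_ψ_indicator_Iio_le hν hpos R
  have hnn : ∀ r, 0 < r → 0 ≤ (Set.Iio R).indicator ν r := fun r hr => by
    by_cases h : r < R
    · simpa [Set.indicator, h] using (hpos r hr).le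
    · simp [Set.indicator, h]
  have hνR := hpos R hR
  have hlim : Tendsto (fun x : ℝ × EuclideanSpace ℝ (Fin d) =>
      x.1 ^ (2 - α - δ) * (‖x.2‖ ^ 2 * |M| * (C * R ^ (-(d + α + δ)) / ν R)))
      (nhdsWithin 0 (Set.Ioi 0) ×ˢ nhds ξ₀) (nhds 0) := by
    have h1 : Tendsto (fun a : ℝ => a ^ (2 - α - δ)) (nhdsWithin 0 (Set.Ioi 0)) (nhds 0) := by
      have h2 := (Real.continuousAt_rpow_const 0 (2 - α - δ) (Or.inr (by linarith))).tendsto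
      rw [Real.zero_rpow (by linarith)] at h2
      exact h2.mono_left nhdsWithin_le_nhds
    have h3 : Tendsto (fun ξ : EuclideanSpace ℝ (Fin d) =>
        ‖ξ‖ ^ 2 * |M| * (C * R ^ (-(d + α + δ)) / ν R)) (nhds ξ₀)
        (nhds (‖ξ₀‖ ^ 2 * |M| * (C * R ^ (-(d + α + δ)) / ν R))) := by
      apply Continuous.tendsto
      fun_prop
    simpa using (h1.comp tendsto_fst).mul (h3.comp tendsto_snd)
  refine tendsto_of_tendsto_of_tendsto_of_le_of_le' tendsto_const_nhds hlim ?_ ?_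
  · have h1 : ∀ᶠ a : ℝ in nhdsWithin 0 (Set.Ioi 0), 0 < a := self_mem_nhdsWithin
    filter_upwards [tendsto_fst.eventually h1] with x hx
    have := hpos _ (inv_pos.2 hx)
    exact div_nonneg (ψ_nonneg hnn _) (by positivity)
  · have h1 : ∀ᶠ a : ℝ in nhdsWithin 0 (Set.Ioi 0), a ∈ Set.Ioo 0 R⁻¹ :=
      Ioo_mem_nhdsGT (inv_pos.2 hR)
    filter_upwards [tendsto_fst.eventually h1] with x hx
    obtain ⟨a, ξ⟩ := x
    obtain ⟨ha, haR⟩ : 0 < a ∧ a < R⁻¹ := hx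
    have hνa := hpos _ (inv_pos.2 ha)
    simp only
    have h2 := (hP R (a⁻¹ / R) le_rfl ((one_le_div hR).2
      ((le_inv_comm₀ ha hR).1 haR.le))).2
    rw [div_mul_cancel₀ _ hR.ne', Real.div_rpow (inv_pos.2 ha).le hR.le,
      Real.inv_rpow ha.le] at h2
    have h3 : 1 ≤ (C * R ^ (-(d + α + δ)) / ν R) * a ^ (-(d + α + δ)) * ν a⁻¹ := by
      rw [Real.rpow_neg ha.le, Real.rpow_neg hR.le]
      calc 1 = ν R / ν R := (div_self hνR.ne').symm
        _ ≤ (C * ((a ^ (d + α + δ))⁻¹ / R ^ (d + α + δ)) * ν a⁻¹) / ν R := by gcongr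
        _ = _ := by ring
    have h4 : ψ d ((Set.Iio R).indicator ν) (a • ξ) ≤ a ^ 2 * (‖ξ‖ ^ 2 * |M|) := by
      refine (hM _).trans ?_
      rw [norm_smul, Real.norm_of_nonneg ha.le, mul_pow, ← mul_assoc]
      gcongr
      exact le_abs_self M
    rw [div_div_eq_mul_div, div_le_iff₀ hνa]
    have h5 : a ^ (2 - α - δ) = a ^ 2 * a ^ d * a ^ (-(d + α + δ)) := by
      rw [← Real.rpow_natCast a 2, ← Real.rpow_natCast a d, ← Real.rpow_add ha,
        ← Real.rpow_add ha]
      congr 1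
      push_cast
      ring
    rw [h5]
    calc ψ d ((Set.Iio R).indicator ν) (a • ξ) * a ^ d
        ≤ a ^ 2 * (‖ξ‖ ^ 2 * |M|) * a ^ d * 1 := by rw [mul_one]; gcongr
      _ ≤ a ^ 2 * (‖ξ‖ ^ 2 * |M|) * a ^ d *
          ((C * R ^ (-(d + α + δ)) / ν R) * a ^ (-(d + α + δ)) * ν a⁻¹) := by gcongr
      _ = _ := by ring

/-- Large jumps dominate the rescaled exponent. -/
lemma tendsto_ψ_large_div (hd : 1 ≤ d) (hν : LevyInt d ν) (hpos : ∀ r, 0 < r → 0 < ν r)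
    (hδ : 0 < δ) (hδα : δ < α) (hδ2 : α + δ < 2) (hR : 0 < R) (hC : 0 < C)
    (hP : PotterBound ν (d + α) δ R C)
    (hrv : ∀ l : ℝ, 0 < l →
      Tendsto (fun r : ℝ => ν (l * r) / ν r) atTop (nhds (l ^ (-(d : ℝ) - α))))
    (ξ₀ : EuclideanSpace ℝ (Fin d)) :
    Tendsto (fun x : ℝ × EuclideanSpace ℝ (Fin d) =>
        ψ d ((Set.Ici R).indicator ν) (x.1 • x.2) / (ν x.1⁻¹ / x.1 ^ d))
      (nhdsWithin 0 (Set.Ioi 0) ×ˢ nhds ξ₀)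
      (nhds (ψ d (fun r => r ^ (-(d : ℝ) - α)) ξ₀)) := by
  have : Nonempty (Fin d) := ⟨⟨0, hd⟩⟩
  have hG : LevyInt d ((Set.Ici R).indicator ν) := hν.indicator measurableSet_Ici
  have hnn : ∀ r, 0 < r → 0 ≤ (Set.Ici R).indicator ν r := fun r hr => by
    by_cases h : R ≤ r
    · simpa [Set.indicator, h] using (hpos r hr).le
    · simp [Set.indicator, h]
  have hev : ∀ᶠ x : ℝ × EuclideanSpace ℝ (Fin d) in nhdsWithin 0 (Set.Ioi 0) ×ˢ nhds ξ₀,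
      x.1 ∈ Set.Ioo 0 R⁻¹ :=
    tendsto_fst.eventually (Ioo_mem_nhdsGT (inv_pos.2 hR))
  have heq : ∀ᶠ x : ℝ × EuclideanSpace ℝ (Fin d) in nhdsWithin 0 (Set.Ioi 0) ×ˢ nhds ξ₀,
      ψ d (fun r => (ν x.1⁻¹)⁻¹ * (Set.Ici R).indicator ν (r / x.1)) x.2 =
      ψ d ((Set.Ici R).indicator ν) (x.1 • x.2) / (ν x.1⁻¹ / x.1 ^ d) := by
    filter_upwards [hev] with x hx
    have ha : x.1 ^ d ≠ 0 := pow_ne_zero d hx.1.ne'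
    rw [ψ_const_mul, ψ_smul _ hx.1]
    field_simp
  refine Tendsto.congr' heq ?_
  refine tendsto_integral_filter_of_dominated_convergence
    (fun z => ((‖ξ₀‖ + 1) ^ 2 + 2) * (C * (min (‖z‖ ^ 2) 1 * ‖z‖ ^ (-(d : ℝ) - (α - δ)) +
      min (‖z‖ ^ 2) 1 * ‖z‖ ^ (-(d : ℝ) - (α + δ))))) ?_ ?_ ?_ ?_
  · filter_upwards [hev] with x hx
    have h1 := ((hG.integrable (x.1 • x.2)).comp_smul (inv_ne_zero hx.1.ne')).const_mul
      (ν x.1⁻¹)⁻¹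
    refine h1.aestronglyMeasurable.congr (Eventually.of_forall fun z => ?_)
    simp only
    rw [real_inner_smul_left, real_inner_smul_right, mul_inv_cancel_left₀ hx.1.ne', norm_smul,
      norm_inv, Real.norm_of_nonneg hx.1.le, inv_mul_eq_div x.1 ‖z‖]
    ring
  · have hball : ∀ᶠ x : ℝ × EuclideanSpace ℝ (Fin d) in nhdsWithin 0 (Set.Ioi 0) ×ˢ nhds ξ₀,
        x.2 ∈ Metric.ball ξ₀ 1 := tendsto_snd.eventually (Metric.ball_mem_nhds ξ₀ one_pos)
    filter_upwards [hev, hball] with x hx hx2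
    have hξ : ‖x.2‖ ≤ ‖ξ₀‖ + 1 := by
      have := norm_le_insert' x.2 ξ₀
      rw [Metric.mem_ball, dist_eq_norm] at hx2
      linarith
    refine Eventually.of_forall fun z => ?_
    by_cases hz : z = 0
    · simp [hz]
    have hz' := norm_pos_iff.2 hz
    have hνa := hpos _ (inv_pos.2 hx.1)
    have h1 := hP.ratio_le hC hpos hx.1 ((le_inv_comm₀ hx.1 hR).1 hx.2.le) hz'
    have h0 := hnn (‖z‖ / x.1) (div_pos hz' hx.1)
    rw [Real.norm_of_nonneg (mul_nonneg (one_sub_cos_nonneg _) (by positivity))]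
    calc _ ≤ ((‖x.2‖ ^ 2 + 2) * min (‖z‖ ^ 2) 1) *
          (C * (‖z‖ ^ (-(d : ℝ) - (α - δ)) + ‖z‖ ^ (-(d : ℝ) - (α + δ)))) :=
          mul_le_mul (one_sub_cos_inner_le _ _) h1 (by positivity) (by positivity)
      _ ≤ (((‖ξ₀‖ + 1) ^ 2 + 2) * min (‖z‖ ^ 2) 1) *
          (C * (‖z‖ ^ (-(d : ℝ) - (α - δ)) + ‖z‖ ^ (-(d : ℝ) - (α + δ)))) := by gcongr
      _ = _ := by ring
  · exact ((Integrable.add (levyInt_rpow hd (by linarith : 0 < α - δ) (by linarith))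
      (levyInt_rpow hd (by linarith : 0 < α + δ) hδ2)).const_mul _).const_mul _
  · refine Eventually.of_forall fun z => ?_
    by_cases hz : z = 0
    · simp [hz]
    have hz' := norm_pos_iff.2 hz
    refine Tendsto.mul ?_ ?_
    · have h : Continuous fun ξ : EuclideanSpace ℝ (Fin d) => 1 - Real.cos ⟪ξ, z⟫ := by fun_prop
      exact (h.tendsto ξ₀).comp tendsto_snd
    · have hinv : Tendsto (fun a : ℝ => a⁻¹) (nhdsWithin 0 (Set.Ioi 0)) atTop :=
        tendsto_inv_nhdsGT_zero
      have h1 := ((hrv ‖z‖ hz').comp hinv).comp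
        (tendsto_fst (f := nhdsWithin (0 : ℝ) (Set.Ioi 0)) (g := nhds ξ₀))
      refine Tendsto.congr' ?_ h1
      filter_upwards [tendsto_fst.eventually (hinv.eventually_ge_atTop (R / ‖z‖))] with x hx
      have h2 : R ≤ ‖z‖ / x.1 := by
        rw [div_le_iff₀ hz'] at hx
        rw [div_eq_mul_inv]
        linarith
      simp only [Function.comp_apply, Set.indicator, Set.mem_Ici, h2, if_true]
      rw [div_eq_inv_mul, div_eq_mul_inv ‖z‖]

/-- Regular variation of the exponent at the origin, locally uniformly in the direction. -/
lemma tendsto_ψ_div (hd : 1 ≤ d) (hν : LevyInt d ν) (hpos : ∀ r, 0 < r → 0 < ν r)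
    (hδ : 0 < δ) (hδα : δ < α) (hδ2 : α + δ < 2) (hR : 0 < R) (hC : 0 < C)
    (hP : PotterBound ν (d + α) δ R C)
    (hrv : ∀ l : ℝ, 0 < l →
      Tendsto (fun r : ℝ => ν (l * r) / ν r) atTop (nhds (l ^ (-(d : ℝ) - α))))
    (ξ₀ : EuclideanSpace ℝ (Fin d)) :
    Tendsto (fun x : ℝ × EuclideanSpace ℝ (Fin d) =>
        ψ d ν (x.1 • x.2) / (ν x.1⁻¹ / x.1 ^ d))
      (nhdsWithin 0 (Set.Ioi 0) ×ˢ nhds ξ₀)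
      (nhds (ψ d (fun r => r ^ (-(d : ℝ) - α)) ξ₀)) := by
  have h := (tendsto_ψ_small_div hν hpos hδ2 hR hP ξ₀).add
    (tendsto_ψ_large_div hd hν hpos hδ hδα hδ2 hR hC hP hrv ξ₀)
  rw [zero_add] at h
  refine h.congr fun x => ?_
  rw [← add_div, ← ψ_add (hν.indicator measurableSet_Iio) (hν.indicator measurableSet_Ici)]
  congr 2
  funext r
  by_cases hr : r < R
  · simp [Set.indicator, hr, not_le.2 hr]
  · simp [Set.indicator, hr, not_lt.1 hr]

/-- Quantitative lower bound of the exponent near the origin. -/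
lemma PotterBound.le_ψ_smul (hP : PotterBound ν (d + α) δ R C) (hR : 0 < R) (hC : 0 < C)
    (hν : LevyInt d ν) (hpos : ∀ r, 0 < r → 0 < ν r)
    (hanti : ∀ r₁ r₂ : ℝ, 0 < r₁ → r₁ ≤ r₂ → ν r₂ ≤ ν r₁)
    {e : EuclideanSpace ℝ (Fin d)} (he : ‖e‖ = 1) {a : ℝ} (ha : 0 < a)
    {ξ : EuclideanSpace ℝ (Fin d)} (hξ : 1 ≤ ‖ξ‖) (haξ : ‖ξ‖ ≤ (a * R)⁻¹) :
    ψ d (ballProfile 1) e / C * ‖ξ‖ ^ (α - δ) * (ν a⁻¹ / a ^ d) ≤ ψ d ν (a • ξ) := by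
  have hn : 0 < ‖ξ‖ := one_pos.trans_le hξ
  have hη : a • ξ ≠ 0 := smul_ne_zero ha.ne' (norm_pos_iff.1 hn)
  have hc := ψ_ballProfile_one_pos he
  have h1 := le_ψ_of_antitone hν (fun r hr => (hpos r hr).le) hanti he hη
  rw [norm_smul, Real.norm_of_nonneg ha.le] at h1
  have hx : R ≤ (a * ‖ξ‖)⁻¹ := by
    rw [le_inv_comm₀ hR (by positivity)]
    rw [mul_inv, inv_mul_eq_div, le_div_iff₀ ha] at haξ
    linarith
  have h2 := (hP (a * ‖ξ‖)⁻¹ ‖ξ‖ hx hξ).1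
  have h3 : ‖ξ‖ * (a * ‖ξ‖)⁻¹ = a⁻¹ := by field_simp
  rw [h3] at h2
  refine le_trans ?_ h1
  have h4 : ‖ξ‖ ^ (α - δ) * ‖ξ‖ ^ (-(d + α - δ)) = (‖ξ‖ ^ d)⁻¹ := by
    rw [← Real.rpow_add hn, ← Real.rpow_natCast, ← Real.rpow_neg hn.le]
    congr 1
    ring
  calc ψ d (ballProfile 1) e / C * ‖ξ‖ ^ (α - δ) * (ν a⁻¹ / a ^ d)
      ≤ ψ d (ballProfile 1) e / C * ‖ξ‖ ^ (α - δ) *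
        ((C * ‖ξ‖ ^ (-(d + α - δ)) * ν (a * ‖ξ‖)⁻¹) / a ^ d) := by gcongr
    _ = ψ d (ballProfile 1) e * (ν (a * ‖ξ‖)⁻¹ / a ^ d) * (C / C) *
        (‖ξ‖ ^ (α - δ) * ‖ξ‖ ^ (-(d + α - δ))) := by ring
    _ = _ := by
      rw [h4, div_self hC.ne', mul_pow, div_mul_eq_div_div]
      ring

/-- Polynomial upper bound of the scaling function near the origin. -/
lemma PotterBound.scale_le (hP : PotterBound ν (d + α) δ R C) (hR : 0 < R)
    {a : ℝ} (ha : 0 < a) (haR : a ≤ R⁻¹) :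
    ν a⁻¹ / a ^ d ≤ C * R ^ (d + α - δ) * ν R * a ^ (α - δ) := by
  have h2 := (hP R (a⁻¹ / R) le_rfl ((one_le_div hR).2 ((le_inv_comm₀ ha hR).1 haR))).1
  rw [div_mul_cancel₀ _ hR.ne', Real.div_rpow (inv_pos.2 ha).le hR.le, Real.inv_rpow ha.le,
    Real.rpow_neg ha.le, Real.rpow_neg hR.le, inv_inv, div_inv_eq_mul] at h2
  rw [div_le_iff₀ (by positivity)]
  refine h2.trans (le_of_eq ?_)
  have h3 : a ^ (d + α - δ) = a ^ (α - δ) * a ^ d := by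
    rw [← Real.rpow_natCast, ← Real.rpow_add ha]
    congr 1
    ring
  rw [h3]
  ring

end RegularVariation

section Inverse

variable {d : ℕ} {ν : ℝ → ℝ}

lemma ψstar_eq_sSup_image {r : ℝ} (hr : 0 ≤ r) :
    ψstar d ν r = sSup ((fun z : EuclideanSpace ℝ (Fin d) => ψ d ν (r • z)) ''
      Metric.closedBall 0 1) := by
  unfold ψstar
  congr 1
  ext y
  simp only [Set.mem_ofPred_eq, Set.mem_image, mem_closedBall_zero_iff]
  constructor
  · rintro ⟨z, hz, rfl⟩
    rcases hr.eq_or_lt with rfl | hr'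
    · have hz0 : z = 0 := norm_le_zero_iff.1 hz
      exact ⟨0, by simp, by simp [hz0]⟩
    · refine ⟨r⁻¹ • z, ?_, by rw [smul_inv_smul₀ hr'.ne']⟩
      rw [norm_smul, norm_inv, Real.norm_of_nonneg hr, inv_mul_le_iff₀ hr', mul_one]
      exact hz
  · rintro ⟨z, hz, rfl⟩
    refine ⟨r • z, ?_, rfl⟩
    rw [norm_smul, Real.norm_of_nonneg hr]
    exact mul_le_of_le_one_right hr hz

lemma LevyInt.continuousOn_ψstar (hν : LevyInt d ν) : ContinuousOn (ψstar d ν) (Set.Ici 0) := by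
  have h : Continuous fun r : ℝ => sSup ((fun z : EuclideanSpace ℝ (Fin d) => ψ d ν (r • z)) ''
      Metric.closedBall 0 1) := by
    refine IsCompact.continuous_sSup (isCompact_closedBall _ _) ?_
    exact hν.continuous_ψ.comp (continuous_fst.smul continuous_snd)
  exact h.continuousOn.congr fun r hr => ψstar_eq_sSup_image hr

lemma LevyInt.le_ψstar (hν : LevyInt d ν) {z : EuclideanSpace ℝ (Fin d)} {r : ℝ} (h : ‖z‖ ≤ r) :
    ψ d ν z ≤ ψstar d ν r := by
  refine le_csSup ?_ ⟨z, h, rfl⟩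
  have h1 := ((isCompact_closedBall (0 : EuclideanSpace ℝ (Fin d)) r).image
    hν.continuous_ψ).bddAbove
  refine h1.mono ?_
  rintro y ⟨w, hw, rfl⟩
  exact ⟨w, mem_closedBall_zero_iff.2 hw, rfl⟩

lemma ψstar_le {r B : ℝ} (hr : 0 ≤ r)
    (h : ∀ z : EuclideanSpace ℝ (Fin d), ‖z‖ ≤ r → ψ d ν z ≤ B) : ψstar d ν r ≤ B := by
  refine csSup_le ⟨ψ d ν 0, 0, by simpa using hr, rfl⟩ ?_
  rintro y ⟨z, hz, rfl⟩
  exact h z hz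

/-- The generalized inverse is attained, positive and bounded by one on `(0, 1)`. -/
lemma LevyInt.ψinv_spec (hν : LevyInt d ν) {e : EuclideanSpace ℝ (Fin d)} (he : ‖e‖ = 1)
    (hψe : ψ d ν e = 1) {u : ℝ} (hu : 0 < u) (hu1 : u < 1) :
    0 < ψinv d ν u ∧ ψstar d ν (ψinv d ν u) = u := by
  have h0 : ψstar d ν 0 = 0 := by
    refine le_antisymm (ψstar_le le_rfl fun z hz => ?_) ?_
    · rw [norm_le_zero_iff.1 hz, ψ_zero]
    · have := hν.le_ψstar (z := 0) (r := 0) (by simp)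
      rwa [ψ_zero] at this
  have h1 : ∀ r, 1 ≤ r → 1 ≤ ψstar d ν r := fun r hr => by
    rw [← hψe]
    exact hν.le_ψstar (he.trans_le hr)
  have hmem : ψinv d ν u ∈ {r : ℝ | 0 ≤ r ∧ ψstar d ν r = u} := by
    refine IsClosed.csSup_mem ?_ ?_ ?_
    · exact hν.continuousOn_ψstar.preimage_isClosed_of_isClosed isClosed_Ici
        (isClosed_singleton (x := u))
    · obtain ⟨r, hr, hru⟩ := intermediate_value_Icc zero_le_one
        (hν.continuousOn_ψstar.mono Set.Icc_subset_Ici_self)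
        (show u ∈ Set.Icc (ψstar d ν 0) (ψstar d ν 1) from
          ⟨by rw [h0]; exact hu.le, hu1.le.trans (h1 1 le_rfl)⟩)
      exact ⟨r, hr.1, hru⟩
    · refine ⟨1, fun r hr => ?_⟩
      by_contra hlt
      have := h1 r (not_le.1 hlt).le
      rw [hr.2] at this
      linarith
  refine ⟨lt_of_le_of_ne hmem.1 fun h => ?_, hmem.2⟩
  have h2 := hmem.2
  rw [← h, h0] at h2
  exact hu.ne h2

/-- The normalizing scale tends to zero. -/
lemma LevyInt.tendsto_ψinv (hν : LevyInt d ν) (hpos : ∀ r, 0 < r → 0 < ν r)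
    (hanti : ∀ r₁ r₂ : ℝ, 0 < r₁ → r₁ ≤ r₂ → ν r₂ ≤ ν r₁)
    {e : EuclideanSpace ℝ (Fin d)} (he : ‖e‖ = 1) (hψe : ψ d ν e = 1) :
    Tendsto (fun s : ℝ => ψinv d ν (1 / s)) atTop (nhdsWithin 0 (Set.Ioi 0)) := by
  have hspec : ∀ᶠ s : ℝ in atTop, 0 < ψinv d ν (1 / s) ∧ ψstar d ν (ψinv d ν (1 / s)) = 1 / s := by
    filter_upwards [eventually_gt_atTop 1] with s hs
    have hs0 : 0 < s := one_pos.trans hs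
    exact hν.ψinv_spec he hψe (by positivity) ((div_lt_one hs0).2 hs)
  rw [tendsto_nhdsWithin_iff]
  refine ⟨?_, hspec.mono fun s hs => hs.1⟩
  rw [Metric.tendsto_nhds]
  intro ε hε
  have he0 : ε • e ≠ 0 := smul_ne_zero hε.ne' (norm_pos_iff.1 (by rw [he]; exact one_pos))
  have hε' : ‖ε • e‖ = ε := by rw [norm_smul, he, mul_one, Real.norm_of_nonneg hε.le]
  have hψε : 0 < ψ d ν (ε • e) := by
    have h1 := le_ψ_of_antitone hν (fun r hr => (hpos r hr).le) hanti he he0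
    rw [hε'] at h1
    have h2 := hpos _ (inv_pos.2 hε)
    have h3 := ψ_ballProfile_one_pos he
    exact lt_of_lt_of_le (by positivity) h1
  have hlim : Tendsto (fun s : ℝ => 1 / s) atTop (nhds 0) := by
    simpa using tendsto_inv_atTop_zero (𝕜 := ℝ)
  filter_upwards [hspec, hlim.eventually_lt_const hψε] with s hs hs2
  rw [Real.dist_eq, sub_zero, abs_of_pos hs.1]
  by_contra hcon
  have := hν.le_ψstar (hε'.trans_le (not_lt.1 hcon))
  rw [hs.2] at this
  linarith

/-- Asymptotics of the maximal exponent, from locally uniform regular variation. -/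
lemma LevyInt.tendsto_ψstar_div (hν : LevyInt d ν) (hpos : ∀ r, 0 < r → 0 < ν r)
    {J : EuclideanSpace ℝ (Fin d) → ℝ} {e : EuclideanSpace ℝ (Fin d)} (he : ‖e‖ = 1)
    (hJ : ∀ ξ, ‖ξ‖ ≤ 1 → J ξ ≤ J e)
    (hlim : ∀ ξ₀, Tendsto (fun x : ℝ × EuclideanSpace ℝ (Fin d) =>
        ψ d ν (x.1 • x.2) / (ν x.1⁻¹ / x.1 ^ d))
      (nhdsWithin 0 (Set.Ioi 0) ×ˢ nhds ξ₀) (nhds (J ξ₀))) :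
    Tendsto (fun a : ℝ => ψstar d ν a / (ν a⁻¹ / a ^ d)) (nhdsWithin 0 (Set.Ioi 0))
      (nhds (J e)) := by
  have hpt : Tendsto (fun a : ℝ => ψ d ν (a • e) / (ν a⁻¹ / a ^ d)) (nhdsWithin 0 (Set.Ioi 0))
      (nhds (J e)) := by
    have h1 : Tendsto (fun a : ℝ => (a, e)) (nhdsWithin 0 (Set.Ioi 0))
        (nhdsWithin 0 (Set.Ioi 0) ×ˢ nhds e) := tendsto_id.prodMk tendsto_const_nhds
    have h2 := Tendsto.comp (g := fun x : ℝ × EuclideanSpace ℝ (Fin d) =>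
      ψ d ν (x.1 • x.2) / (ν x.1⁻¹ / x.1 ^ d)) (hlim e) h1
    simpa only [Function.comp_def] using h2
  have hg : ∀ a : ℝ, 0 < a → 0 < ν a⁻¹ / a ^ d := fun a ha =>
    div_pos (hpos _ (inv_pos.2 ha)) (pow_pos ha d)
  rw [tendsto_order]
  constructor
  · intro b hb
    filter_upwards [hpt.eventually_const_lt hb, self_mem_nhdsWithin] with a ha ha0
    have ha0' : 0 < a := ha0
    refine ha.trans_le ?_
    have := hg a ha0'
    have h1 : ψ d ν (a • e) ≤ ψstar d ν a :=
      hν.le_ψstar (by rw [norm_smul, he, mul_one, Real.norm_of_nonneg ha0'.le])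
    gcongr
  · intro b hb
    obtain ⟨b', hb1, hb2⟩ := exists_between hb
    have hev : ∀ᶠ a : ℝ in nhds 0, ∀ ξ ∈ Metric.closedBall (0 : EuclideanSpace ℝ (Fin d)) 1,
        0 < a → ψ d ν (a • ξ) / (ν a⁻¹ / a ^ d) < b' := by
      refine IsCompact.eventually_forall_of_forall_eventually (isCompact_closedBall _ _)
        fun ξ hξ => ?_
      have h1 := (hlim ξ).eventually_lt_const
        ((hJ ξ (mem_closedBall_zero_iff.1 hξ)).trans_lt hb1)
      rw [← nhdsWithin_univ ξ, ← nhdsWithin_prod_eq, eventually_nhdsWithin_iff] at h1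
      exact h1.mono fun x hx hx0 => hx ⟨hx0, Set.mem_univ _⟩
    filter_upwards [nhdsWithin_le_nhds hev, self_mem_nhdsWithin] with a ha ha0
    have ha0' : 0 < a := ha0
    refine lt_of_le_of_lt ?_ hb2
    have hga := hg a ha0'
    rw [div_le_iff₀ hga, ψstar_eq_sSup_image ha0'.le]
    refine csSup_le ⟨_, 0, by simp, rfl⟩ ?_
    rintro y ⟨ξ, hξ, rfl⟩
    exact (div_le_iff₀ hga).1 (ha ξ hξ ha0').le

end Inverse

section HeatKernel

variable {d : ℕ} {ν : ℝ → ℝ}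

/-- Integrability of the stretched exponential. -/
lemma integrable_exp_neg_mul_norm_rpow (hd : 1 ≤ d) {β κ : ℝ} (hβ : 0 < β) (hκ : 0 < κ) :
    Integrable (fun ξ : EuclideanSpace ℝ (Fin d) => Real.exp (-κ * ‖ξ‖ ^ β)) := by
  have : Nonempty (Fin d) := ⟨⟨0, hd⟩⟩
  refine (integrable_fun_norm_addHaar (volume : Measure (EuclideanSpace ℝ (Fin d)))
    (f := fun r : ℝ => Real.exp (-κ * r ^ β))).2 ?_
  rw [finrank_euclideanSpace_fin]
  have hq : (-1 : ℝ) < ((d - 1 : ℕ) : ℝ) := by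
    have : (0 : ℝ) ≤ ((d - 1 : ℕ) : ℝ) := Nat.cast_nonneg _
    linarith
  have h1 := integral_rpow_mul_exp_neg_mul_rpow hβ hq hκ
  have h2 : IntegrableOn (fun r : ℝ => r ^ ((d - 1 : ℕ) : ℝ) * Real.exp (-κ * r ^ β))
      (Set.Ioi 0) := by
    refine Integrable.of_integral_ne_zero ?_
    rw [h1]
    have h3 : 0 < Real.Gamma ((((d - 1 : ℕ) : ℝ) + 1) / β) :=
      Real.Gamma_pos_of_pos (div_pos (by linarith) hβ)
    positivity
  refine h2.congr_fun (fun r _ => ?_) measurableSet_Ioi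
  simp only [Real.rpow_natCast, smul_eq_mul]

/-- Fourier integrals converge when the exponents converge pointwise, have a common power lower
bound on growing balls `‖ξ‖ ≤ r s`, and are negligible outside these balls. -/
lemma tendsto_integral_cos_mul_exp (hd : 1 ≤ d) {Ψ : ℝ → EuclideanSpace ℝ (Fin d) → ℝ}
    {Φ : EuclideanSpace ℝ (Fin d) → ℝ} {r A : ℝ → ℝ} {B : ℝ → EuclideanSpace ℝ (Fin d) → ℝ}
    {β κ t : ℝ} (hβ : 0 < β) (hκ : 0 < κ) (ht : 0 < t) (x : EuclideanSpace ℝ (Fin d))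
    (hcont : ∀ s, Continuous (Ψ s))
    (hlim : ∀ ξ, Tendsto (fun s => Ψ s ξ) atTop (nhds (Φ ξ)))
    (hr : Tendsto r atTop atTop)
    (hnear : ∀ᶠ s in atTop, ∀ ξ, ‖ξ‖ ≤ r s → κ * (‖ξ‖ ^ β - 1) ≤ Ψ s ξ)
    (hfar : ∀ᶠ s in atTop, ∀ ξ, r s < ‖ξ‖ → Real.exp (-(t * Ψ s ξ)) ≤ B s ξ)
    (hB0 : ∀ᶠ s in atTop, ∀ ξ, 0 ≤ B s ξ)
    (hB : ∀ᶠ s in atTop, Integrable (B s))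
    (hA : ∀ᶠ s in atTop, ∫ ξ, B s ξ ≤ A s)
    (hA0 : Tendsto A atTop (nhds 0)) :
    Tendsto (fun s => ∫ ξ : EuclideanSpace ℝ (Fin d),
        Real.cos ⟪ξ, x⟫ * Real.exp (-(t * Ψ s ξ))) atTop
      (nhds (∫ ξ : EuclideanSpace ℝ (Fin d), Real.cos ⟪ξ, x⟫ * Real.exp (-(t * Φ ξ)))) := by
  set F : ℝ → EuclideanSpace ℝ (Fin d) → ℝ := fun s ξ =>
    Real.cos ⟪ξ, x⟫ * Real.exp (-(t * Ψ s ξ)) with hF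
  have hFc : ∀ s, Continuous (F s) := fun s => by
    have := hcont s
    fun_prop
  have hFle : ∀ s ξ, ‖F s ξ‖ ≤ Real.exp (-(t * Ψ s ξ)) := fun s ξ => by
    rw [hF, norm_mul, Real.norm_of_nonneg (Real.exp_pos _).le]
    exact mul_le_of_le_one_left (Real.exp_pos _).le (Real.abs_cos_le_one _)
  set S : ℝ → Set (EuclideanSpace ℝ (Fin d)) := fun s => Metric.closedBall 0 (r s) with hS
  have hSm : ∀ s, MeasurableSet (S s) := fun s => measurableSet_closedBall
  set D : EuclideanSpace ℝ (Fin d) → ℝ := fun ξ =>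
    Real.exp (t * κ) * Real.exp (-(t * κ) * ‖ξ‖ ^ β) with hD
  have hDi : Integrable D :=
    (integrable_exp_neg_mul_norm_rpow hd hβ (by positivity)).const_mul _
  have hDle : ∀ᶠ s in atTop, ∀ ξ, ‖(S s).indicator (F s) ξ‖ ≤ D ξ := by
    filter_upwards [hnear] with s hs ξ
    by_cases hξ : ξ ∈ S s
    · rw [Set.indicator_of_mem hξ]
      refine (hFle s ξ).trans ?_
      simp only [hD, ← Real.exp_add]
      refine Real.exp_le_exp.2 ?_
      have h1 := mul_le_mul_of_nonneg_left (hs ξ (mem_closedBall_zero_iff.1 hξ)) ht.le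
      linarith
    · rw [Set.indicator_of_notMem hξ, norm_zero]
      positivity
  have hBle : ∀ᶠ s in atTop, ∀ ξ, ‖(S s)ᶜ.indicator (F s) ξ‖ ≤ B s ξ := by
    filter_upwards [hfar, hB0] with s hs hs0 ξ
    by_cases hξ : ξ ∈ (S s)ᶜ
    · rw [Set.indicator_of_mem hξ]
      refine (hFle s ξ).trans (hs ξ ?_)
      simpa [hS] using hξ
    · rw [Set.indicator_of_notMem hξ, norm_zero]
      exact hs0 ξ
  have h1 : Tendsto (fun s => ∫ ξ, (S s).indicator (F s) ξ) atTop
      (nhds (∫ ξ : EuclideanSpace ℝ (Fin d), Real.cos ⟪ξ, x⟫ * Real.exp (-(t * Φ ξ)))) := by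
    refine tendsto_integral_filter_of_dominated_convergence D ?_
      (hDle.mono fun s hs => Eventually.of_forall hs) hDi (Eventually.of_forall fun ξ => ?_)
    · exact Eventually.of_forall fun s =>
        ((hFc s).aestronglyMeasurable).indicator (hSm s)
    · have h2 : Tendsto (fun s => F s ξ) atTop
          (nhds (Real.cos ⟪ξ, x⟫ * Real.exp (-(t * Φ ξ)))) :=
        (((hlim ξ).const_mul t).neg.rexp).const_mul _
      refine h2.congr' ?_
      filter_upwards [hr.eventually_ge_atTop ‖ξ‖] with s hs
      rw [Set.indicator_of_mem (mem_closedBall_zero_iff.2 hs)]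
  have h2 : Tendsto (fun s => ∫ ξ, (S s)ᶜ.indicator (F s) ξ) atTop (nhds 0) := by
    refine squeeze_zero_norm' ?_ hA0
    filter_upwards [hBle, hB, hA] with s hs hsB hsA
    exact (norm_integral_le_of_norm_le hsB (Eventually.of_forall hs)).trans hsA
  have h3 := h1.add h2
  rw [add_zero] at h3
  refine h3.congr' ?_
  filter_upwards [hDle, hBle, hB] with s hs1 hs2 hsB
  rw [← integral_add
    (hDi.mono' ((hFc s).aestronglyMeasurable.indicator (hSm s)) (Eventually.of_forall hs1))
    (hsB.mono' ((hFc s).aestronglyMeasurable.indicator (hSm s).compl)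
      (Eventually.of_forall hs2))]
  refine integral_congr_ae (Eventually.of_forall fun ξ => ?_)
  exact congrFun (Set.indicator_self_add_compl (S s) (F s)) ξ

end HeatKernel

theorem statement12
    (d : ℕ) (hd : 1 ≤ d) (ν : ℝ → ℝ)
    (hν_pos : ∀ r : ℝ, 0 < r → 0 < ν r)
    (hν_mono : ∀ r₁ r₂ : ℝ, 0 < r₁ → r₁ ≤ r₂ → ν r₂ ≤ ν r₁)
    (hint : Integrable (fun z : EuclideanSpace ℝ (Fin d) => min (‖z‖ ^ 2) 1 * ν ‖z‖))
    (hninf : ¬ Integrable (fun z : EuclideanSpace ℝ (Fin d) => ν ‖z‖))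
    (α : ℝ) (hα : α ∈ Set.Ioo (0:ℝ) 2)
    (hA2 : ∀ lam : ℝ, 0 < lam →
      Tendsto (fun r : ℝ => ν (lam * r) / ν r) atTop (nhds (lam ^ (-(d:ℝ) - α))))
    (t₀ : ℝ) (ht₀ : 0 < t₀)
    (hA3 : Integrable (fun ξ : EuclideanSpace ℝ (Fin d) => Real.exp (-(t₀ * ψ d ν ξ))))
    (hnorm : ∀ ξ : EuclideanSpace ℝ (Fin d), ‖ξ‖ = 1 → ψ d ν ξ = 1)
:
    ∀ t : ℝ, 0 < t → ∀ x : EuclideanSpace ℝ (Fin d),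
      Tendsto (fun s : ℝ => pts d ν s t x) atTop (nhds (ptα d α t x)) := by
  intro t ht x
  have hν : LevyInt d ν := hint
  have : Nonempty (Fin d) := ⟨⟨0, hd⟩⟩
  obtain ⟨e, he⟩ := exists_norm_eq (EuclideanSpace ℝ (Fin d)) zero_le_one
  have hψe := hnorm e he
  obtain ⟨hα0, hα2⟩ := hα
  obtain ⟨δ, hδ, hδlt⟩ := exists_between (lt_min hα0 (sub_pos.2 hα2))
  have hδα : δ < α := hδlt.trans_le (min_le_left _ _)
  have hδ2 : α + δ < 2 := by linarith [hδlt.trans_le (min_le_right _ _)]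
  have hβ : 0 < α - δ := sub_pos.2 hδα
  have hd0 : (0 : ℝ) ≤ d := Nat.cast_nonneg d
  obtain ⟨R, hR, C, hC, hP⟩ := exists_potter hν_pos hν_mono (p := d + α) hδ (by linarith)
    (by have h := hA2 2 two_pos
        rwa [show -(d : ℝ) - α = -(d + α) by ring] at h)
  set J : EuclideanSpace ℝ (Fin d) → ℝ := ψ d (fun r => r ^ (-(d : ℝ) - α)) with hJdef
  have hJpos : 0 < J e := ψ_rpow_pos hd hα0 hα2 he
  have hJ : ∀ ξ, J ξ = ‖ξ‖ ^ α * J e := ψ_rpow_eq α hα0 he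
  have hlim := tendsto_ψ_div hd hν hν_pos hδ hδα hδ2 hR hC hP hA2
  have hstar := hν.tendsto_ψstar_div hν_pos (J := J) he (fun ξ hξ => by
    rw [hJ ξ]
    exact mul_le_of_le_one_left hJpos.le (Real.rpow_le_one (norm_nonneg _) hξ hα0.le)) hlim
  set a : ℝ → ℝ := fun s => ψinv d ν (1 / s) with hadef
  have ha : Tendsto a atTop (nhdsWithin 0 (Set.Ioi 0)) :=
    hν.tendsto_ψinv hν_pos hν_mono he hψe
  have hapos : ∀ᶠ s in atTop, 0 < a s := ha.eventually self_mem_nhdsWithin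
  have haR : ∀ᶠ s in atTop, a s ≤ R⁻¹ :=
    (ha.eventually (Ioo_mem_nhdsGT (inv_pos.2 hR))).mono fun s hs => hs.2.le
  have hastar : ∀ᶠ s in atTop, ψstar d ν (a s) = 1 / s := by
    filter_upwards [eventually_gt_atTop 1] with s hs
    have hs0 : 0 < s := one_pos.trans hs
    exact (hν.ψinv_spec he hψe (by positivity) ((div_lt_one hs0).2 hs)).2
  set g : ℝ → ℝ := fun s => ν (a s)⁻¹ / a s ^ d with hgdef
  have hscale : Tendsto (fun s => s * g s) atTop (nhds (J e)⁻¹) := by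
    refine ((hstar.comp ha).inv₀ hJpos.ne').congr' ?_
    filter_upwards [hastar] with s hs
    simp only [Function.comp_apply]
    rw [hs, div_div, one_div, inv_inv]
  have hψs : ∀ ξ, Tendsto (fun s => ψs d ν s ξ) atTop (nhds (‖ξ‖ ^ α)) := by
    intro ξ
    have h0 : Tendsto (fun s => (a s, ξ)) atTop (nhdsWithin 0 (Set.Ioi 0) ×ˢ nhds ξ) :=
      ha.prodMk tendsto_const_nhds
    have h1 := Tendsto.comp (g := fun x : ℝ × EuclideanSpace ℝ (Fin d) =>
      ψ d ν (x.1 • x.2) / (ν x.1⁻¹ / x.1 ^ d)) (hlim ξ) h0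
    have h2 := hscale.mul h1
    rw [← hJdef, hJ ξ, mul_comm (‖ξ‖ ^ α), inv_mul_cancel_left₀ hJpos.ne'] at h2
    refine h2.congr' ?_
    filter_upwards [hapos] with s hs
    have h3 : g s ≠ 0 := (div_pos (hν_pos _ (inv_pos.2 hs)) (pow_pos hs d)).ne'
    simp only [Function.comp_apply]
    change s * g s * (ψ d ν (a s • ξ) / g s) = s * ψ d ν (a s • ξ)
    rw [mul_assoc, mul_div_cancel₀ _ h3]
  set κ₀ := (J e)⁻¹ / 2 with hκ₀
  have hκ₀pos : 0 < κ₀ := by positivity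
  have hsg : ∀ᶠ s in atTop, κ₀ < s * g s :=
    hscale.eventually_const_lt (half_lt_self (inv_pos.2 hJpos))
  have hc := ψ_ballProfile_one_pos he
  set κ := ψ d (ballProfile 1) e / C * κ₀ with hκdef
  have hκ : 0 < κ := by positivity
  obtain ⟨m, hm, hmle⟩ := exists_pos_le_ψ hd hν hν_pos hν_mono (inv_pos.2 hR)
  have hψnn : ∀ ξ, 0 ≤ ψ d ν ξ := ψ_nonneg fun r hr => (hν_pos r hr).le
  set L := C * R ^ (d + α - δ) * ν R with hL
  have hLpos : 0 < L := by
    have := hν_pos R hR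
    positivity
  set I := ∫ ξ : EuclideanSpace ℝ (Fin d), Real.exp (-(t₀ * ψ d ν ξ)) with hI
  have hI0 : 0 ≤ I := integral_nonneg fun ξ => (Real.exp_pos _).le
  refine Tendsto.const_mul _ ?_
  refine tendsto_integral_cos_mul_exp hd (r := fun s => (a s * R)⁻¹)
    (B := fun s ξ => Real.exp (-((t * s - t₀) * m)) * Real.exp (-(t₀ * ψ d ν (a s • ξ))))
    (A := fun s => (L / κ₀) ^ (d / (α - δ)) * Real.exp (t₀ * m) * I *
      (s ^ (d / (α - δ)) * Real.exp (-(t * m) * s)))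
    hβ hκ ht x ?_ hψs ?_ ?_ ?_ ?_ ?_ ?_ ?_
  · intro s
    exact continuous_const.mul (hν.continuous_ψ.comp (continuous_const_smul _))
  · have h1 := tendsto_inv_nhdsGT_zero.comp ha
    refine (h1.atTop_mul_const (inv_pos.2 hR)).congr fun s => ?_
    rw [mul_inv]
    rfl
  · filter_upwards [hapos, hsg, eventually_gt_atTop 0] with s hs hsg hs0 ξ hξ
    rcases le_total ‖ξ‖ 1 with h | h
    · have h1 : ‖ξ‖ ^ (α - δ) ≤ 1 := Real.rpow_le_one (norm_nonneg _) h hβ.le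
      have h2 : 0 ≤ ψs d ν s ξ := mul_nonneg hs0.le (hψnn _)
      nlinarith
    · have h1 := hP.le_ψ_smul hR hC hν hν_pos hν_mono he hs h hξ
      calc κ * (‖ξ‖ ^ (α - δ) - 1) ≤ κ * ‖ξ‖ ^ (α - δ) := by gcongr; linarith
        _ = ψ d (ballProfile 1) e / C * ‖ξ‖ ^ (α - δ) * κ₀ := by ring
        _ ≤ ψ d (ballProfile 1) e / C * ‖ξ‖ ^ (α - δ) * (s * g s) := by gcongr
        _ = s * (ψ d (ballProfile 1) e / C * ‖ξ‖ ^ (α - δ) * g s) := by ring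
        _ ≤ s * ψ d ν (a s • ξ) := by gcongr
  · filter_upwards [hapos, eventually_ge_atTop (t₀ / t)] with s hs hst ξ hξ
    rw [← Real.exp_add]
    refine Real.exp_le_exp.2 ?_
    have h1 : m ≤ ψ d ν (a s • ξ) := by
      refine hmle _ ?_
      rw [norm_smul, Real.norm_of_nonneg hs.le]
      have h2 := mul_le_mul_of_nonneg_left hξ.le hs.le
      rwa [mul_inv, mul_inv_cancel_left₀ hs.ne'] at h2
    have h3 : 0 ≤ t * s - t₀ := by
      rw [div_le_iff₀ ht] at hst
      linarith
    have h4 := mul_le_mul_of_nonneg_left h1 h3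
    have h5 : t * ψs d ν s ξ = (t * s - t₀) * ψ d ν (a s • ξ) + t₀ * ψ d ν (a s • ξ) := by
      change t * (s * ψ d ν (a s • ξ)) = _
      ring
    linarith
  · exact Eventually.of_forall fun s ξ => by positivity
  · filter_upwards [hapos] with s hs
    exact (hA3.comp_smul hs.ne').const_mul _
  · filter_upwards [hapos, haR, hsg, eventually_gt_atTop 0] with s hs hsR hsg hs0
    rw [integral_const_mul, Measure.integral_comp_smul volume
      (fun ξ : EuclideanSpace ℝ (Fin d) => Real.exp (-(t₀ * ψ d ν ξ))),
      finrank_euclideanSpace_fin, abs_of_pos (by positivity), smul_eq_mul, ← hI]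
    have h1 : κ₀ ≤ s * (L * a s ^ (α - δ)) :=
      hsg.le.trans (mul_le_mul_of_nonneg_left (hP.scale_le hR hs hsR) hs0.le)
    have h2 : (a s ^ (α - δ))⁻¹ ≤ L / κ₀ * s := by
      rw [inv_le_iff_one_le_mul₀ (by positivity), div_mul_eq_mul_div, div_mul_eq_mul_div,
        le_div_iff₀ hκ₀pos]
      linarith
    have h3 : (a s ^ d)⁻¹ ≤ (L / κ₀) ^ (d / (α - δ)) * s ^ (d / (α - δ)) := by
      rw [← Real.mul_rpow (by positivity) hs0.le]
      refine le_trans (le_of_eq ?_) (Real.rpow_le_rpow (by positivity) h2 (by positivity))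
      rw [Real.inv_rpow (by positivity), ← Real.rpow_mul hs.le, mul_div_cancel₀ _ hβ.ne',
        Real.rpow_natCast]
    have h4 : Real.exp (-((t * s - t₀) * m)) = Real.exp (t₀ * m) * Real.exp (-(t * m) * s) := by
      rw [← Real.exp_add]
      congr 1
      ring
    rw [h4]
    calc _ ≤ Real.exp (t₀ * m) * Real.exp (-(t * m) * s) *
          (((L / κ₀) ^ (d / (α - δ)) * s ^ (d / (α - δ))) * I) := by gcongr
      _ = _ := by ring
  · have h1 := tendsto_rpow_mul_exp_neg_mul_atTop_nhds_zero (d / (α - δ)) (t * m) (by positivity)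
    simpa using h1.const_mul ((L / κ₀) ^ (d / (α - δ)) * Real.exp (t₀ * m) * I)

end
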